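/- Let c ∈ ℝ⁴ be a base quadruple of a bounded Apollonian packing and let s ∈ ℝ⁴. Then the family (exp(−⟨w·c, s⟩))_{w ∈ W} is summable if and only if there exists w ∈ W* such that w·s ∈ C, i.e. all four coordinates of w·s are nonnegative and at most one of them is zero. (The domain of absolute convergence of Z(s) is the Apollonian cone A = ⋃_{w∈W*} w(C).) -/

import Mathlib

open Finset Complex

noncomputable section

/-- The Descartes quadratic form `F(x) = 2(x₁²+x₂²+x₃²+x₄²) − (x₁+x₂+x₃+x₄)²`. -/
def DescartesF (x : Fin 4 → ℝ) : ℝ := 2 * (∑ i, (x i)^2) - (∑ i, x i)^2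

/-- Height of a vector: the sum of its coordinates. -/
def ht (x : Fin 4 → ℝ) : ℝ := ∑ i, x i

/-- The Apollonian reflection as a linear map: it replaces the `i`-th coordinate `xᵢ`
by `2(Σ_{j≠i} xⱼ) − xᵢ = 2(Σ_j xⱼ) − 3xᵢ` and fixes the other coordinates. -/
def sigmaL (i : Fin 4) : (Fin 4 → ℝ) →ₗ[ℝ] (Fin 4 → ℝ) where
  toFun x := Function.update x i (2 * (∑ j, x j) - 3 * x i)
  map_add' x y := by
    funext j
    rcases eq_or_ne j i with h | h
    · subst h; simp [Function.update_self, Finset.sum_add_distrib]; ring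
    · simp [Function.update_of_ne h]
  map_smul' r x := by
    funext j
    rcases eq_or_ne j i with h | h
    · subst h
      simp only [Pi.smul_apply, smul_eq_mul, Function.update_self, RingHom.id_apply]
      rw [← Finset.mul_sum]
      ring
    · simp [Function.update_of_ne h]

lemma sigmaL_invol (i : Fin 4) : Function.Involutive (sigmaL i) := by
  intro x
  funext j
  have hsum : ∑ k, Function.update x i (2 * (∑ j, x j) - 3 * x i) k
      = 3 * (∑ k, x k) - 4 * x i := by
    rw [Finset.sum_update_of_mem (Finset.mem_univ i)]
    have : ∑ k ∈ Finset.univ \ {i}, x k = (∑ k, x k) - x i := by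
      rw [Finset.sum_sdiff_eq_sub (Finset.subset_univ _), Finset.sum_singleton]
    rw [this]; ring
  rcases eq_or_ne j i with h | h
  · subst h
    simp only [sigmaL, LinearMap.coe_mk, AddHom.coe_mk, Function.update_self, hsum]
    ring
  · simp [sigmaL, Function.update_of_ne h]

/-- The Apollonian reflection `σᵢ` as a linear automorphism of `ℝ⁴`. -/
def apSigma (i : Fin 4) : (Fin 4 → ℝ) ≃ₗ[ℝ] (Fin 4 → ℝ) :=
  LinearEquiv.ofInvolutive (sigmaL i) (sigmaL_invol i)

/-- The Apollonian group `W`, generated by the four reflections `σ₁, σ₂, σ₃, σ₄`. -/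
def apW : Subgroup ((Fin 4 → ℝ) ≃ₗ[ℝ] (Fin 4 → ℝ)) :=
  Subgroup.closure {apSigma 0, apSigma 1, apSigma 2, apSigma 3}

/-- The pairing `⟨x,s⟩ = x₁s₁+x₂s₂+x₃s₃+x₄s₄` of real vectors. -/
def pairR (x s : Fin 4 → ℝ) : ℝ := ∑ i, x i * s i

/-- `c` is a base quadruple of a bounded Apollonian packing: `F(c) = 0`, exactly one
coordinate of `c` is negative, and `2cᵢ ≤ ht(c)` for every `i`. -/
def IsBaseQuadruple (c : Fin 4 → ℝ) : Prop :=
  DescartesF c = 0 ∧ (∃! i, c i < 0) ∧ ∀ i, 2 * c i ≤ ht c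

/-- The dual Apollonian reflection as a linear map: it sends `s` to the vector with `i`-th
coordinate `−sᵢ` and `j`-th coordinate `sⱼ + 2sᵢ` for `j ≠ i`. -/
def tauL (i : Fin 4) : (Fin 4 → ℝ) →ₗ[ℝ] (Fin 4 → ℝ) where
  toFun s := fun j => if j = i then -s i else s j + 2 * s i
  map_add' x y := by
    funext j
    rcases eq_or_ne j i with h | h <;> simp [h] <;> ring
  map_smul' r x := by
    funext j
    rcases eq_or_ne j i with h | h <;> simp [h] <;> ring

lemma tauL_invol (i : Fin 4) : Function.Involutive (tauL i) := by
  intro x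
  funext j
  rcases eq_or_ne j i with h | h <;> simp [tauL, h] <;> ring

/-- The dual Apollonian reflection `τᵢ` (the transpose of `σᵢ`) as a linear automorphism. -/
def apTau (i : Fin 4) : (Fin 4 → ℝ) ≃ₗ[ℝ] (Fin 4 → ℝ) :=
  LinearEquiv.ofInvolutive (tauL i) (tauL_invol i)

/-- The dual Apollonian group `W* = ⟨τ₁, τ₂, τ₃, τ₄⟩`. -/
def apWstar : Subgroup ((Fin 4 → ℝ) ≃ₗ[ℝ] (Fin 4 → ℝ)) :=
  Subgroup.closure {apTau 0, apTau 1, apTau 2, apTau 3}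

/-- The set `C = {s ∈ ℝ⁴ : sᵢ ≥ 0 for all i, and at most one sᵢ = 0}`. -/
def setC : Set (Fin 4 → ℝ) :=
  {s | (∀ i, 0 ≤ s i) ∧ ∀ i j, s i = 0 → s j = 0 → i = j}

lemma pair_adj (i : Fin 4) (x s : Fin 4 → ℝ) :
    pairR (apSigma i x) s = pairR x (apTau i s) := by
  change pairR (sigmaL i x) s = pairR x (tauL i s)
  fin_cases i <;>
    simp [pairR, sigmaL, tauL, Fin.sum_univ_four, Function.update_apply] <;> ring

lemma sigma_sq (i : Fin 4) : apSigma i * apSigma i = 1 := by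
  ext1 x
  exact sigmaL_invol i x

lemma tau_apply (i : Fin 4) (s : Fin 4 → ℝ) (j : Fin 4) :
    apTau i s j = if j = i then -s i else s j + 2 * s i := rfl

lemma tau_self (i : Fin 4) (s : Fin 4 → ℝ) : apTau i s i = -s i := by
  simp [tau_apply]

lemma tau_ne (i : Fin 4) (s : Fin 4 → ℝ) (j : Fin 4) (h : j ≠ i) :
    apTau i s j = s j + 2 * s i := by
  simp [tau_apply, h]

lemma sigma_mem (i : Fin 4) : apSigma i ∈ apW := by
  apply Subgroup.subset_closure
  fin_cases i <;> simp

lemma tau_mem (i : Fin 4) : apTau i ∈ apWstar := by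
  apply Subgroup.subset_closure
  fin_cases i <;> simp

lemma F_sigma (i : Fin 4) (x : Fin 4 → ℝ) : DescartesF (apSigma i x) = DescartesF x := by
  change DescartesF (sigmaL i x) = DescartesF x
  fin_cases i <;>
    simp [DescartesF, sigmaL, Fin.sum_univ_four, Function.update_apply] <;> ring

lemma F_tau (i : Fin 4) (x : Fin 4 → ℝ) : DescartesF (apTau i x) = DescartesF x := by
  change DescartesF (tauL i x) = DescartesF x
  fin_cases i <;>
    simp [DescartesF, tauL, Fin.sum_univ_four] <;> ring

lemma ht_tau (i : Fin 4) (x : Fin 4 → ℝ) : ht (apTau i x) = ht x + 4 * x i := by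
  change ht (tauL i x) = _
  fin_cases i <;>
    simp [ht, tauL, Fin.sum_univ_four] <;> ring

/-- Reduced words, together with their transposes. -/
inductive Red : Option (Fin 4) → ((Fin 4 → ℝ) ≃ₗ[ℝ] (Fin 4 → ℝ)) →
    ((Fin 4 → ℝ) ≃ₗ[ℝ] (Fin 4 → ℝ)) → Prop
  | one : Red none 1 1
  | mul (i : Fin 4) (o : Option (Fin 4)) (w v : (Fin 4 → ℝ) ≃ₗ[ℝ] (Fin 4 → ℝ)) :
      Red o w v → o ≠ some i → Red (some i) (w * apSigma i) (apTau i * v)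

lemma Red.adj {o w v} (h : Red o w v) : ∀ x s, pairR (w x) s = pairR x (v s) := by
  induction h with
  | one => intro x s; rfl
  | mul i o w v _ _ ih =>
    intro x s
    rw [LinearEquiv.mul_apply, LinearEquiv.mul_apply, ih, pair_adj]

lemma Red.mem_star {o w v} (h : Red o w v) : v ∈ apWstar := by
  induction h with
  | one => exact one_mem _
  | mul i o w v _ _ ih => exact mul_mem (tau_mem i) ih

lemma Red.F_left {o w v} (h : Red o w v) : ∀ x, DescartesF (w x) = DescartesF x := by
  induction h with
  | one => intro x; rfl
  | mul i o w v _ _ ih => intro x; rw [LinearEquiv.mul_apply, ih, F_sigma]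

lemma Red.F_right {o w v} (h : Red o w v) : ∀ x, DescartesF (v x) = DescartesF x := by
  induction h with
  | one => intro x; rfl
  | mul i o w v _ _ ih => intro x; rw [LinearEquiv.mul_apply, F_tau, ih]

lemma Red.int {o w v} (h : Red o w v) : ∃ n : Fin 4 → ℤ, ∀ j, v (fun _ => 1) j = n j := by
  induction h with
  | one => exact ⟨fun _ => 1, fun j => by simp⟩
  | mul i o w v _ _ ih =>
    obtain ⟨n, hn⟩ := ih
    refine ⟨fun j => if j = i then -n i else n j + 2 * n i, fun j => ?_⟩
    rw [LinearEquiv.mul_apply, tau_apply, hn, hn]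
    by_cases e : j = i <;> simp [e]

lemma Red.nonneg {o w v} (h : Red o w v) (s : Fin 4 → ℝ) (hs : ∀ i, 0 ≤ s i) :
    (∀ i, o ≠ some i → 0 ≤ v s i) ∧ (∀ i j, i ≠ j → 0 ≤ v s i + v s j) ∧
    ∀ i, ht s - 2 * s i ≤ ht (v s) - 2 * v s i := by
  induction h with
  | one => exact ⟨fun i _ => hs i, fun i j _ => add_nonneg (hs i) (hs j), fun i => le_refl _⟩
  | mul i o w v _ ho ih =>
    obtain ⟨h1, h2, h3⟩ := ih
    have hi := h1 i ho
    have key : ∀ j, j ≠ i → 0 ≤ v s j + 2 * v s i := fun j hj => by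
      linarith [h2 j i hj]
    refine ⟨fun j hj => ?_, fun j k hjk => ?_, fun j => ?_⟩
    · have hj' : j ≠ i := fun e => hj (by rw [e])
      rw [LinearEquiv.mul_apply, tau_ne _ _ _ hj']
      exact key j hj'
    · rw [LinearEquiv.mul_apply]
      rcases eq_or_ne j i with e | e
      · subst e
        rw [tau_self, tau_ne _ _ _ hjk.symm]
        linarith [h2 j k hjk]
      · rcases eq_or_ne k i with e' | e'
        · subst e'
          rw [tau_self, tau_ne _ _ _ e]
          linarith [h2 j k hjk]
        · rw [tau_ne _ _ _ e, tau_ne _ _ _ e']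
          linarith [key j e, key k e']
    · rw [LinearEquiv.mul_apply, ht_tau]
      rcases eq_or_ne j i with e | e
      · subst e
        rw [tau_self]
        linarith [h3 j]
      · rw [tau_ne _ _ _ e]
        linarith [h3 j]

lemma Red.pos {o w v} (h : Red o w v) :
    (∀ i, o ≠ some i → 0 < v (fun _ => 1) i) ∧
    (∀ i j, i ≠ j → 0 < v (fun _ => 1) i + v (fun _ => 1) j) ∧
    ∀ i, o = some i → v (fun _ => 1) i < 0 := by
  induction h with
  | one => exact ⟨fun i _ => by simp, fun i j _ => by simp, fun i h => by simp at h⟩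
  | mul i o w v _ ho ih =>
    obtain ⟨h1, h2, h3⟩ := ih
    have hi := h1 i ho
    have key : ∀ j, j ≠ i → 0 < v (fun _ => 1) j + 2 * v (fun _ => 1) i := fun j hj => by
      linarith [h2 j i hj]
    refine ⟨fun j hj => ?_, fun j k hjk => ?_, fun j hj => ?_⟩
    · have hj' : j ≠ i := fun e => hj (by rw [e])
      rw [LinearEquiv.mul_apply, tau_ne _ _ _ hj']
      exact key j hj'
    · rw [LinearEquiv.mul_apply]
      rcases eq_or_ne j i with e | e
      · subst e
        rw [tau_self, tau_ne _ _ _ hjk.symm]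
        linarith [h2 j k hjk]
      · rcases eq_or_ne k i with e' | e'
        · subst e'
          rw [tau_self, tau_ne _ _ _ e]
          linarith [h2 j k hjk]
        · rw [tau_ne _ _ _ e, tau_ne _ _ _ e']
          linarith [key j e, key k e']
    · have : i = j := by simpa using hj
      subst this
      rw [LinearEquiv.mul_apply, tau_self]
      linarith

lemma Red.mul_right {o w v} (h : Red o w v) (i : Fin 4) : ∃ o' v', Red o' (w * apSigma i) v' := by
  by_cases ho : o = some i
  · subst ho
    cases h with
    | mul i o w v h _ => exact ⟨o, v, by rwa [mul_assoc, sigma_sq, mul_one]⟩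
  · exact ⟨_, _, Red.mul i o w v h ho⟩

lemma sigma_inv (i : Fin 4) : (apSigma i)⁻¹ = apSigma i :=
  inv_eq_of_mul_eq_one_left (sigma_sq i)

lemma exists_red (w : (Fin 4 → ℝ) ≃ₗ[ℝ] (Fin 4 → ℝ)) (hw : w ∈ apW) : ∃ o v, Red o w v := by
  have hg : ∀ y ∈ ({apSigma 0, apSigma 1, apSigma 2, apSigma 3} :
      Set ((Fin 4 → ℝ) ≃ₗ[ℝ] (Fin 4 → ℝ))), ∃ i, y = apSigma i := by
    intro y hy
    simp only [Set.mem_insert_iff, Set.mem_singleton_iff] at hy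
    rcases hy with h | h | h | h <;> exact ⟨_, h⟩
  unfold apW at hw
  induction hw using Subgroup.closure_induction_right with
  | one => exact ⟨_, _, Red.one⟩
  | mul_right x hx y hy ih =>
    obtain ⟨i, rfl⟩ := hg y hy
    obtain ⟨o, v, h⟩ := ih
    exact h.mul_right i
  | mul_inv_cancel x hx y hy ih =>
    obtain ⟨i, rfl⟩ := hg y hy
    obtain ⟨o, v, h⟩ := ih
    rw [sigma_inv]
    exact h.mul_right i

lemma exists_adj (v : (Fin 4 → ℝ) ≃ₗ[ℝ] (Fin 4 → ℝ)) (hv : v ∈ apWstar) :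
    ∃ w ∈ apW, ∀ x s, pairR (w x) s = pairR x (v s) := by
  have hg : ∀ y ∈ ({apTau 0, apTau 1, apTau 2, apTau 3} :
      Set ((Fin 4 → ℝ) ≃ₗ[ℝ] (Fin 4 → ℝ))), ∃ i, y = apTau i := by
    intro y hy
    simp only [Set.mem_insert_iff, Set.mem_singleton_iff] at hy
    rcases hy with h | h | h | h <;> exact ⟨_, h⟩
  unfold apWstar at hv
  induction hv using Subgroup.closure_induction with
  | mem y hy =>
    obtain ⟨i, rfl⟩ := hg y hy
    exact ⟨_, sigma_mem i, pair_adj i⟩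
  | one => exact ⟨1, one_mem _, fun _ _ => rfl⟩
  | mul x y _ _ hx hy =>
    obtain ⟨a, ha, ha'⟩ := hx
    obtain ⟨b, hb, hb'⟩ := hy
    exact ⟨b * a, mul_mem hb ha, fun z s => by
      rw [LinearEquiv.mul_apply, LinearEquiv.mul_apply, hb', ha']⟩
  | inv x _ hx =>
    obtain ⟨a, ha, ha'⟩ := hx
    refine ⟨a⁻¹, inv_mem ha, fun z s => ?_⟩
    have h1 : x (x⁻¹ s) = s := by
      rw [← LinearEquiv.mul_apply, mul_inv_cancel]; rfl
    have h2 : a (a⁻¹ z) = z := by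
      rw [← LinearEquiv.mul_apply, mul_inv_cancel]; rfl
    conv_lhs => rw [← h1]
    rw [← ha', h2]

lemma pair_one (x : Fin 4 → ℝ) : pairR x (fun _ => 1) = ht x := by
  simp [pairR, ht]

lemma pair_single (i : Fin 4) (s : Fin 4 → ℝ) : pairR (Pi.single i 1) s = s i := by
  simp [pairR, Pi.single_apply]

lemma pair_single' (i : Fin 4) (s : Fin 4 → ℝ) : pairR s (Pi.single i 1) = s i := by
  simp [pairR, Pi.single_apply]

lemma red_inj {o w v o' w' v'} (h : Red o w v) (h' : Red o' w' v') (hw : w ∈ apW)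
    (hw' : w' ∈ apW) (e : v (fun _ => 1) = v' (fun _ => 1)) : w = w' := by
  have hh : ∀ x, ht (w x) = ht (w' x) := fun x => by
    rw [← pair_one, ← pair_one, h.adj, h'.adj, e]
  obtain ⟨q, k, hk⟩ := exists_red (w * w'⁻¹) (mul_mem hw (inv_mem hw'))
  have h1 : ∀ i, k (fun _ => 1) i = 1 := fun i => by
    have h2 : ∀ x, w' (w'⁻¹ x) = x := fun x => by
      rw [← LinearEquiv.mul_apply, mul_inv_cancel]; rfl
    rw [← pair_single i (k _), ← hk.adj, pair_one, LinearEquiv.mul_apply, hh, h2, ← pair_one,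
      pair_single]
  rcases q with _ | i
  · generalize hg : w * w'⁻¹ = g at hk
    cases hk
    exact mul_inv_eq_one.mp hg
  · have := hk.pos.2.2 i rfl
    rw [h1] at this
    linarith

/-- Pairing with a chamber vector. -/
lemma pair_chamber (c u : Fin 4 → ℝ) :
    pairR c u = ∑ i, (ht c - 2 * c i) * (ht u - 2 * u i) / 4 := by
  simp [pairR, ht, Fin.sum_univ_four]; ring

lemma base_nonneg {c} (hc : IsBaseQuadruple c) (i : Fin 4) : 0 ≤ ht c - 2 * c i := by
  linarith [hc.2.2 i]

lemma base_zero {c} (hc : IsBaseQuadruple c) (i j : Fin 4) (hi : ht c - 2 * c i = 0)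
    (hj : ht c - 2 * c j = 0) : i = j := by
  by_contra hne
  obtain ⟨hF, ⟨k, hk, hku⟩, -⟩ := hc
  have hcc : ∀ m, m ≠ i → m ≠ j → c m = 0 := by
    intro m h1 h2
    have : (c m) ^ 2 ≤ 0 := by
      unfold DescartesF at hF
      unfold ht at hi hj
      rw [Fin.sum_univ_four] at hi hj
      simp only [Fin.sum_univ_four] at hF
      have hij : c i = c j := by linarith
      have e1 : c 0 + c 1 + c 2 + c 3 = 2 * c i := by linarith
      have e2 : (c i) ^ 2 = (c j) ^ 2 := by rw [hij]
      rw [e1] at hF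
      clear hi hj hij e1
      fin_cases i <;> fin_cases j <;> fin_cases m <;> simp at hne h1 h2 e2 hF ⊢ <;>
        nlinarith [sq_nonneg (c 0), sq_nonneg (c 1), sq_nonneg (c 2), sq_nonneg (c 3)]
    nlinarith [sq_nonneg (c m)]
  have hij : c i = c j := by linarith
  by_cases hki : k = i
  · subst hki
    exact hne (hku j (by simpa [← hij] using hk)).symm
  · by_cases hkj : k = j
    · subst hkj
      exact hki (hku i (by simpa [hij] using hk)).symm
    · have := hcc k hki hkj
      simp [this] at hk

lemma F_split (x : Fin 4 → ℝ) (m : Fin 4) :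
    ∃ q, (ht x - x m) ^ 2 ≤ 3 * q ∧ DescartesF x = 2 * ((x m) ^ 2 + q) - (ht x) ^ 2 := by
  refine ⟨(∑ i, (x i) ^ 2) - (x m) ^ 2, ?_, ?_⟩
  · simp only [ht, Fin.sum_univ_four]
    fin_cases m <;> simp <;>
      nlinarith [sq_nonneg (x 0 - x 1), sq_nonneg (x 0 - x 2), sq_nonneg (x 0 - x 3),
        sq_nonneg (x 1 - x 2), sq_nonneg (x 1 - x 3), sq_nonneg (x 2 - x 3)]
  · unfold DescartesF ht; ring

/-- In the cone, the total is controlled by any three coordinates. -/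
lemma three_bound (x : Fin 4 → ℝ) (hF : DescartesF x ≤ 0) (hx : 0 < ht x) (m : Fin 4) :
    ht x ≤ 4 * (ht x - x m) := by
  obtain ⟨q, hq, e⟩ := F_split x m
  set T := ht x - x m with hT
  have hh : ht x = T + x m := by rw [hT]; ring
  rw [hh] at hx e ⊢
  rw [e] at hF
  have hT0 : 0 ≤ T := by
    by_contra hneg
    push Not at hneg
    nlinarith
  by_contra hcon
  push Not at hcon
  nlinarith

lemma chamber_F (u : Fin 4 → ℝ) :
    DescartesF (fun i => ht u - 2 * u i) = 4 * DescartesF u := by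
  simp only [DescartesF, ht, Fin.sum_univ_four]; ring

lemma chamber_ht (u : Fin 4 → ℝ) : ht (fun i => ht u - 2 * u i) = 2 * ht u := by
  simp only [ht, Fin.sum_univ_four]; ring

/-- a nonnegative vector with at most one zero pairs well with a cone vector -/
lemma pair_lower (s : Fin 4 → ℝ) (hs : s ∈ setC) : ∃ ε > 0, ∀ A : ℝ, 0 ≤ A →
    ∃ K, ∀ x : Fin 4 → ℝ, (∀ i, -A ≤ x i) → DescartesF x ≤ 0 → 0 < ht x →
      ε * ht x - A * K ≤ pairR x s := by
  obtain ⟨h0, h1⟩ := hs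
  obtain ⟨m, hm⟩ : ∃ m, ∀ j, j ≠ m → 0 < s j := by
    by_cases h : ∃ m, s m = 0
    · obtain ⟨m, hm⟩ := h
      exact ⟨m, fun j hj => lt_of_le_of_ne (h0 j) fun e => hj (h1 j m e.symm hm)⟩
    · push Not at h
      exact ⟨0, fun j _ => lt_of_le_of_ne (h0 j) (h j).symm⟩
  obtain ⟨ε, hε, hεs⟩ : ∃ ε > 0, ∀ j, j ≠ m → ε ≤ s j := by
    refine ⟨Finset.univ.inf' Finset.univ_nonempty (fun j => if j = m then 1 else s j), ?_, ?_⟩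
    · rw [gt_iff_lt, Finset.lt_inf'_iff]
      intro j _
      split_ifs with h
      · norm_num
      · exact hm j h
    · intro j hj
      have := Finset.inf'_le (s := Finset.univ) (fun j => if j = m then 1 else s j)
        (Finset.mem_univ j)
      rw [if_neg hj] at this
      exact this
  refine ⟨ε / 4, by positivity, fun A hA => ⟨ht s, fun x hx hF hp => ?_⟩⟩
  have h3 := three_bound x hF hp m
  have key : ∀ j, (if j = m then 0 else ε * x j) ≤ (x j + A) * s j := by
    intro j
    split_ifs with h
    · exact mul_nonneg (by linarith [hx j]) (h0 j)
    · nlinarith [hx j, hεs j h]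
  have hs := Finset.sum_le_sum (fun j (_ : j ∈ Finset.univ) => key j)
  have e1 : ∑ j, (if j = m then 0 else ε * x j) = ε * (ht x - x m) := by
    simp only [ht, Fin.sum_univ_four]
    fin_cases m <;> simp <;> ring
  have e2 : ∑ j, (x j + A) * s j = pairR x s + A * ht s := by
    simp only [ht, pairR, Fin.sum_univ_four]; ring
  rw [e1, e2] at hs
  nlinarith

lemma ht_bound {c} (hc : IsBaseQuadruple c) : ∃ η > 0, ∀ o w v, Red o w v →
    0 < ht (w c) ∧ η * ∑ i, |v (fun _ => 1) i| ≤ ht (w c) := by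
  have hC : (fun i => ht c - 2 * c i) ∈ setC :=
    ⟨base_nonneg hc, fun i j hi hj => base_zero hc i j hi hj⟩
  obtain ⟨ε, hε, h⟩ := pair_lower _ hC
  obtain ⟨K, hK⟩ := h 0 le_rfl
  refine ⟨ε / 16, by positivity, fun o w v hr => ?_⟩
  set u := v (fun _ => 1) with hu
  have h1 : ht (w c) = pairR (fun i => ht u - 2 * u i) (fun i => ht c - 2 * c i) / 4 := by
    rw [← pair_one, hr.adj, ← hu, pair_chamber, pairR, ← Finset.sum_div]
    congr 1
    exact Finset.sum_congr rfl fun i _ => mul_comm _ _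
  have h2 : ∀ i, 2 ≤ ht u - 2 * u i := fun i => by
    have := (hr.nonneg (fun _ => 1) (fun _ => zero_le_one)).2.2 i
    rw [← hu] at this
    have e : ht (fun _ => (1:ℝ)) = 4 := by simp [ht]
    rw [e] at this
    linarith
  have hFu : DescartesF u ≤ 0 := by
    rw [hu, hr.F_right]
    simp [DescartesF]; norm_num
  have hsum : 0 < ht u := by
    have : ht u = (∑ i, (ht u - 2 * u i)) / 2 := by
      simp only [ht, Fin.sum_univ_four]; ring
    rw [this, Fin.sum_univ_four]
    linarith [h2 0, h2 1, h2 2, h2 3]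
  have h3 := hK (fun i => ht u - 2 * u i) (fun i => by linarith [h2 i])
    (by rw [chamber_F]; linarith) (by rw [chamber_ht]; linarith)
  rw [chamber_ht, zero_mul, sub_zero] at h3
  have h4 : ∑ i, |u i| ≤ 8 * ht u := by
    have : ∀ i, |u i| ≤ 2 * ht u := by
      intro i
      have e : ht u = u 0 + u 1 + u 2 + u 3 := by simp [ht, Fin.sum_univ_four]
      rw [abs_le]
      have a0 := h2 0
      have a1 := h2 1
      have a2 := h2 2
      have a3 := h2 3
      fin_cases i <;> simp <;> constructor <;> linarith
    rw [Fin.sum_univ_four]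
    linarith [this 0, this 1, this 2, this 3]
  rw [h1]
  constructor
  · have : 0 < ε * (2 * ht u) := by positivity
    linarith
  · have := mul_le_mul_of_nonneg_left h4 hε.le
    linarith

lemma summable_int (κ : ℝ) (hκ : 0 < κ) : Summable fun n : ℤ => Real.exp (-κ * |(n : ℝ)|) := by
  have h : Summable fun n : ℕ => Real.exp (-κ * n) := by
    have := Real.summable_exp_nat_mul_iff.mpr (neg_lt_zero.mpr hκ)
    simpa [mul_comm] using this
  apply Summable.of_nat_of_neg
  · simpa using h
  · simpa using h

lemma summable_int4 (κ : ℝ) (hκ : 0 < κ) :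
    Summable fun n : Fin 4 → ℤ => Real.exp (-κ * ∑ i, |(n i : ℝ)|) := by
  have h1 := summable_int κ hκ
  have h2 := h1.mul_of_nonneg h1 (fun _ => (Real.exp_pos _).le) (fun _ => (Real.exp_pos _).le)
  have h4 := h2.mul_of_nonneg h2 (fun _ => by positivity) (fun _ => by positivity)
  have hinj : Function.Injective (fun n : Fin 4 → ℤ => ((n 0, n 1), (n 2, n 3))) := by
    intro a b h
    simp only [Prod.mk.injEq] at h
    funext i
    fin_cases i <;> simp [h]
  refine (h4.comp_injective hinj).congr fun n => ?_
  simp only [Function.comp, Fin.sum_univ_four, ← Real.exp_add]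
  congr 1; ring

lemma summable_of_mem {c} (hc : IsBaseQuadruple c) (s : Fin 4 → ℝ) (hs : s ∈ setC) :
    Summable fun w : apW => Real.exp (-pairR ((w : (Fin 4 → ℝ) ≃ₗ[ℝ] (Fin 4 → ℝ)) c) s) := by
  obtain ⟨η, hη, hb⟩ := ht_bound hc
  obtain ⟨ε, hε, h⟩ := pair_lower s hs
  set A := ∑ i, |c i| with hA
  obtain ⟨K, hK⟩ := h A (Finset.sum_nonneg fun i _ => abs_nonneg _)
  choose o v hr using fun w : apW => exists_red w.1 w.2
  choose n hn using fun w : apW => (hr w).int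
  have hinj : Function.Injective n := by
    intro w w' e
    apply Subtype.ext
    refine red_inj (hr w) (hr w') w.2 w'.2 ?_
    funext i
    rw [hn, hn, e]
  have hsum := ((summable_int4 (ε * η) (by positivity)).comp_injective hinj).mul_left
    (Real.exp (A * K))
  refine Summable.of_nonneg_of_le (fun _ => (Real.exp_pos _).le) (fun w => ?_) hsum
  simp only [Function.comp]
  rw [← Real.exp_add, Real.exp_le_exp]
  have hx : ∀ i, -A ≤ (w : (Fin 4 → ℝ) ≃ₗ[ℝ] (Fin 4 → ℝ)) c i := by
    intro i
    have h1 : c i ≤ (w : (Fin 4 → ℝ) ≃ₗ[ℝ] (Fin 4 → ℝ)) c i := by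
      rw [← pair_single' i c, ← pair_single' i (w.1 c), (hr w).adj, pair_chamber,
        pair_chamber c (v w _)]
      apply Finset.sum_le_sum
      intro j _
      have := ((hr w).nonneg (Pi.single i 1) (fun k => by
        rw [Pi.single_apply]; split_ifs <;> norm_num)).2.2 j
      have := mul_le_mul_of_nonneg_left this (base_nonneg hc j)
      linarith
    have h2 : |c i| ≤ A := Finset.single_le_sum (f := fun i => |c i|)
      (fun i _ => abs_nonneg _) (Finset.mem_univ i)
    linarith [neg_abs_le (c i)]
  obtain ⟨hp, hq⟩ := hb _ _ _ (hr w)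
  have h3 := hK _ hx (by rw [(hr w).F_left, hc.1]) hp
  have h4 : ∑ i, |v w (fun _ => 1) i| = ∑ i, |(n w i : ℝ)| :=
    Finset.sum_congr rfl fun i _ => by rw [hn]
  rw [h4] at hq
  have := mul_le_mul_of_nonneg_left hq hε.le
  linarith

lemma summable_shift (c s : Fin 4 → ℝ) (w v : (Fin 4 → ℝ) ≃ₗ[ℝ] (Fin 4 → ℝ)) (hw : w ∈ apW)
    (h : ∀ x s, pairR (w x) s = pairR x (v s)) :
    (Summable fun g : apW => Real.exp (-pairR ((g : (Fin 4 → ℝ) ≃ₗ[ℝ] (Fin 4 → ℝ)) c) (v s))) ↔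
    Summable fun g : apW => Real.exp (-pairR ((g : (Fin 4 → ℝ) ≃ₗ[ℝ] (Fin 4 → ℝ)) c) s) := by
  rw [← (Equiv.mulLeft (⟨w, hw⟩ : apW)).summable_iff (f := fun g : apW =>
    Real.exp (-pairR ((g : (Fin 4 → ℝ) ≃ₗ[ℝ] (Fin 4 → ℝ)) c) s))]
  apply summable_congr
  intro g
  simp [← h]

lemma exists_nonneg {c} (hc : IsBaseQuadruple c) (u : Fin 4 → ℝ)
    (hmin : ∀ w ∈ apW, pairR c u ≤ pairR (w c) u) : ∃ v ∈ apWstar, ∀ i, 0 ≤ v u i := by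
  have key : ∀ t : Fin 4 → ℝ, ∀ i, pairR (apSigma i c) t = pairR c t +
      2 * ((ht c - 2 * c i) * t i) := by
    intro t i
    rw [pair_adj]
    simp only [pairR, ht, tau_apply, Fin.sum_univ_four]
    fin_cases i <;> simp <;> ring
  have main : ∀ t : Fin 4 → ℝ, (∀ w ∈ apW, pairR c t ≤ pairR (w c) t) →
      ∀ i, ht c - 2 * c i ≠ 0 → 0 ≤ t i := by
    intro t ht' i hi
    have h1 := ht' _ (sigma_mem i)
    rw [key] at h1
    have h2 : 0 < ht c - 2 * c i := lt_of_le_of_ne (base_nonneg hc i) hi.symm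
    by_contra hneg
    push Not at hneg
    have := mul_neg_of_pos_of_neg h2 hneg
    linarith
  by_cases hall : ∀ i, 0 ≤ u i
  · exact ⟨1, one_mem _, hall⟩
  push Not at hall
  obtain ⟨j, hj⟩ := hall
  have haj : ht c - 2 * c j = 0 := by
    by_contra h
    linarith [main u hmin j h]
  refine ⟨apTau j, tau_mem j, fun i => ?_⟩
  rcases eq_or_ne i j with e | e
  · subst e
    rw [tau_self]; linarith
  · refine main (apTau j u) (fun w hw => ?_) i fun h => e (base_zero hc i j h haj)
    rw [← pair_adj, ← pair_adj, key, haj]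
    have := hmin (apSigma j * w) (mul_mem (sigma_mem j) hw)
    rw [LinearEquiv.mul_apply] at this
    linarith

lemma dihedral (i j : Fin 4) (hij : i ≠ j) (x : Fin 4 → ℝ) (n : ℕ) :
    ht (((apSigma i * apSigma j) ^ n) x) - ((apSigma i * apSigma j) ^ n) x i
      - ((apSigma i * apSigma j) ^ n) x j = ht x - x i - x j ∧
    ((apSigma i * apSigma j) ^ n) x i - ((apSigma i * apSigma j) ^ n) x j =
      x i - x j + 4 * n * (ht x - x i - x j) := by
  have step : ∀ y, ht (apSigma i (apSigma j y)) - apSigma i (apSigma j y) i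
      - apSigma i (apSigma j y) j = ht y - y i - y j ∧
      apSigma i (apSigma j y) i - apSigma i (apSigma j y) j =
        y i - y j + 4 * (ht y - y i - y j) := by
    intro y
    change ht (sigmaL i (sigmaL j y)) - sigmaL i (sigmaL j y) i
      - sigmaL i (sigmaL j y) j = ht y - y i - y j ∧
      sigmaL i (sigmaL j y) i - sigmaL i (sigmaL j y) j =
        y i - y j + 4 * (ht y - y i - y j)
    fin_cases i <;> fin_cases j <;> simp at hij <;> constructor <;>
      simp [sigmaL, ht, Fin.sum_univ_four, Function.update_apply] <;> ring
  induction n with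
  | zero => simp
  | succ n ih =>
    rw [pow_succ', LinearEquiv.mul_apply, LinearEquiv.mul_apply]
    obtain ⟨h1, h2⟩ := step (((apSigma i * apSigma j) ^ n) x)
    rw [h1, h2, ih.1, ih.2]
    refine ⟨rfl, ?_⟩
    push_cast; ring

lemma not_two_zero (c u : Fin 4 → ℝ) (h : Summable fun w : apW =>
      Real.exp (-pairR ((w : (Fin 4 → ℝ) ≃ₗ[ℝ] (Fin 4 → ℝ)) c) u))
    (i j : Fin 4) (hi : u i = 0) (hj : u j = 0) : i = j := by
  by_contra hij
  let g : apW := ⟨apSigma i * apSigma j, mul_mem (sigma_mem i) (sigma_mem j)⟩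
  have hinj : Function.Injective (fun n : ℕ => g ^ n) := by
    intro m n hmn
    have e : (apSigma i * apSigma j) ^ m = (apSigma i * apSigma j) ^ n := by
      simpa [g] using congrArg Subtype.val hmn
    have h1 := (dihedral i j hij (fun _ => 1) m).2
    rw [e, (dihedral i j hij (fun _ => 1) n).2] at h1
    simp [ht] at h1
    rcases h1 with h1 | h1
    · exact h1.symm
    · norm_num at h1
  have fixt : ∀ k, u k = 0 → apTau k u = u := by
    intro k hk
    funext l
    rw [tau_apply]
    split_ifs with e
    · rw [e, hk]; simp
    · rw [hk]; simp
  have hconst : ∀ n : ℕ, pairR (((apSigma i * apSigma j) ^ n) c) u = pairR c u := by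
    intro n
    induction n with
    | zero => rfl
    | succ n ih =>
      rw [pow_succ', LinearEquiv.mul_apply, LinearEquiv.mul_apply, pair_adj, fixt i hi, pair_adj,
        fixt j hj, ih]
  have h2 := h.comp_injective hinj
  have h3 : Summable fun _ : ℕ => Real.exp (-pairR c u) := by
    refine h2.congr fun n => ?_
    simp [g, hconst]
  rw [summable_const_iff] at h3
  exact (Real.exp_pos _).ne' h3

lemma exists_min (c s : Fin 4 → ℝ) (h : Summable fun w : apW =>
      Real.exp (-pairR ((w : (Fin 4 → ℝ) ≃ₗ[ℝ] (Fin 4 → ℝ)) c) s)) :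
    ∃ w0 : apW, ∀ w : apW, pairR (w0.1 c) s ≤ pairR (w.1 c) s := by
  have h1 := h.tendsto_cofinite_zero.eventually (gt_mem_nhds (Real.exp_pos (-pairR c s)))
  rw [Filter.eventually_cofinite] at h1
  simp only [not_lt, Real.exp_le_exp, neg_le_neg_iff] at h1
  obtain ⟨w0, hw0, hm⟩ := Set.exists_min_image _ (fun w : apW => pairR (w.1 c) s) h1
    ⟨1, le_refl (pairR c s)⟩
  refine ⟨w0, fun w => ?_⟩
  by_cases hw : pairR (w.1 c) s ≤ pairR c s
  · exact hm w hw
  · exact le_trans hw0 (le_of_not_ge hw)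

/-- The domain of absolute convergence of `Z(s)` is the Apollonian cone
`A = ⋃_{w ∈ W*} w(C)`. -/
theorem summable_iff_mem_apollonian_cone (c : Fin 4 → ℝ) (hc : IsBaseQuadruple c)
    (s : Fin 4 → ℝ) :
    (Summable fun w : apW => Real.exp (-pairR ((w : (Fin 4 → ℝ) ≃ₗ[ℝ] (Fin 4 → ℝ)) c) s)) ↔
      ∃ w ∈ apWstar, (w : (Fin 4 → ℝ) ≃ₗ[ℝ] (Fin 4 → ℝ)) s ∈ setC := by
  constructor
  · intro h
    obtain ⟨w0, hw0⟩ := exists_min c s h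
    obtain ⟨o, v, hr⟩ := exists_red w0.1 w0.2
    obtain ⟨v', hv', hnn⟩ := exists_nonneg hc (v s) (fun w hw => by
      rw [← hr.adj, ← hr.adj]
      exact hw0 (w0 * ⟨w, hw⟩))
    obtain ⟨w', hw', hadj⟩ := exists_adj v' hv'
    refine ⟨v' * v, mul_mem hv' hr.mem_star, hnn, ?_⟩
    apply not_two_zero c
    rw [LinearEquiv.mul_apply]
    rw [summable_shift c (v s) w' v' hw' hadj, summable_shift c s w0.1 v w0.2 hr.adj]
    exact h
  · rintro ⟨v, hv, hvs⟩
    obtain ⟨w, hw, hadj⟩ := exists_adj v hv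
    rw [← summable_shift c s w v hw hadj]
    exact summable_of_mem hc _ hvs
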